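/- The map I ↦ F_I is a bijection from the collection of μ-connected subsets of Π onto the collection of nonempty fundamental faces of H, and it is an order isomorphism: for μ-connected I, I' ⊆ Π one has I ⊆ I' if and only if F_I ⊆ F_{I'}. -/

import Mathlib

open Set Module

noncomputable section

/-- The linear reflection `x ↦ x - f x • a` associated to a vector `a` and a linear
functional `f` with `f a = 2`, bundled as a linear automorphism. -/
def reflEquiv {V : Type*} [AddCommGroup V] [Module ℝ V]
    (a : V) (f : V →ₗ[ℝ] ℝ) (h2 : f a = 2) : V ≃ₗ[ℝ] V :=
  LinearEquiv.ofInvolutive (LinearMap.id - f.smulRight a)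
    (fun x => by
      simp only [LinearMap.sub_apply, LinearMap.id_apply, LinearMap.smulRight_apply,
        map_sub, map_smul, smul_eq_mul, h2]
      module)

/-- A realization over `ℝ` of an `m × m` generalized Cartan matrix `A`:
simple roots `α_i`, simple coroots `α_i∨` (as linear functionals), with
`⟨α_j, α_i∨⟩ = a_{ij}`, together with the defining axioms. -/
structure GCMRealization (m : ℕ) (V : Type*) [NormedAddCommGroup V] [NormedSpace ℝ V] where
  A : Matrix (Fin m) (Fin m) ℤ
  root : Fin m → V
  coroot : Fin m → V →ₗ[ℝ] ℝ
  one_le_m : 1 ≤ m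
  A_diag : ∀ i, A i i = 2
  A_offdiag : ∀ i j, i ≠ j → A i j ≤ 0
  A_zero_iff : ∀ i j, A i j = 0 ↔ A j i = 0
  root_indep : LinearIndependent ℝ root
  coroot_indep : LinearIndependent ℝ coroot
  pairing : ∀ i j, coroot i (root j) = (A i j : ℝ)
  finDim : FiniteDimensional ℝ V
  dim_eq : finrank ℝ V + (A.map ((↑) : ℤ → ℝ)).rank = 2 * m

/-- A face of a convex set `H`: a convex subset `F ⊆ H` such that whenever the open
segment between two points of `H` meets `F`, both points lie in `F`. -/
def IsFaceOf {V : Type*} [NormedAddCommGroup V] [NormedSpace ℝ V] (H F : Set V) : Prop :=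
  Convex ℝ F ∧ IsExtreme ℝ H F

namespace GCMRealization

variable {m : ℕ} {V : Type*} [NormedAddCommGroup V] [NormedSpace ℝ V]
variable (S : GCMRealization m V)

/-- The fundamental reflection `r_i`. -/
def s (i : Fin m) : V ≃ₗ[ℝ] V :=
  reflEquiv (S.root i) (S.coroot i) (by
    have h := S.pairing i i
    rw [S.A_diag i] at h
    simpa using h)

/-- The Weyl group `W`, as a subgroup of the group of linear automorphisms of `V`. -/
def W : Subgroup (V ≃ₗ[ℝ] V) := Subgroup.closure (Set.range S.s)

/-- The standard parabolic subgroup `W_I` generated by the reflections indexed by `I`. -/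
def WI (I : Set (Fin m)) : Subgroup (V ≃ₗ[ℝ] V) := Subgroup.closure (S.s '' I)

/-- The closed fundamental chamber `C̄`. -/
def chamber : Set V := {η | ∀ i, 0 ≤ S.coroot i η}

/-- `J₀`: the set of indices `i` with `⟨μ, α_i∨⟩ = 0`. -/
def J0 (μ : V) : Set (Fin m) := {i | S.coroot i μ = 0}

/-- The orbit of `μ` under a subgroup of linear automorphisms. -/
def orbitOf (G : Subgroup (V ≃ₗ[ℝ] V)) (μ : V) : Set V :=
  (fun w : V ≃ₗ[ℝ] V => w μ) '' (G : Set (V ≃ₗ[ℝ] V))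

/-- `F_I`: the convex hull of `W_I · μ`. -/
def face (μ : V) (I : Set (Fin m)) : Set V := convexHull ℝ (orbitOf (S.WI I) μ)

/-- `H`: the convex hull of the Weyl group orbit of `μ`. -/
def orbitHull (μ : V) : Set V := convexHull ℝ (orbitOf S.W μ)

/-- `ℝ₊I`: the set of nonnegative linear combinations of the simple roots indexed by `I`. -/
def coneNonneg (I : Set (Fin m)) : Set V :=
  {v | ∃ c : Fin m → ℝ, (∀ i, 0 ≤ c i) ∧ (∀ i, i ∉ I → c i = 0) ∧ v = ∑ i, c i • S.root i}

/-- `ℝ_>I`: the set of strictly positive linear combinations of the simple roots indexed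
by `I` (with `ℝ_>∅ = {0}`). -/
def conePos (I : Set (Fin m)) : Set V :=
  {v | ∃ c : Fin m → ℝ, (∀ i ∈ I, 0 < c i) ∧ (∀ i, i ∉ I → c i = 0) ∧ v = ∑ i, c i • S.root i}

/-- The open standard facet `C_J`. -/
def openFacet (J : Set (Fin m)) : Set V :=
  {η | (∀ i ∈ J, S.coroot i η = 0) ∧ ∀ i, i ∉ J → 0 < S.coroot i η}

/-- The closed standard facet `C̄_J`. -/
def closedFacet (J : Set (Fin m)) : Set V :=
  {η | (∀ i ∈ J, S.coroot i η = 0) ∧ ∀ i, i ∉ J → 0 ≤ S.coroot i η}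

/-- Adjacency of two vertices of the Dynkin diagram: `i ≠ j` and `a_{ij} ≠ 0`
(equivalently `a_{ji} ≠ 0`). -/
def Adjacent (i j : Fin m) : Prop := i ≠ j ∧ S.A i j ≠ 0 ∧ S.A j i ≠ 0

/-- The Dynkin diagram, as a simple graph on the index set. -/
def diagram : SimpleGraph (Fin m) where
  Adj := S.Adjacent
  symm := ⟨fun _ _ h => ⟨h.1.symm, h.2.2, h.2.1⟩⟩
  loopless := ⟨fun _ h => h.1 rfl⟩

/-- A subset `I` is `μ`-connected if every connected component of `I` meets
`J_> = Π \ J₀` (the empty set is `μ`-connected). -/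
def MuConnected (μ : V) (I : Set (Fin m)) : Prop :=
  ∀ i : I, ∃ j : I, S.coroot (j : Fin m) μ ≠ 0 ∧ (S.diagram.induce I).Reachable i j

/-- The connected component of `i` inside `K`, as a subset of the index set. -/
def comp (K : Set (Fin m)) (i : Fin m) : Set (Fin m) :=
  {j | ∃ (hi : i ∈ K) (hj : j ∈ K), (S.diagram.induce K).Reachable ⟨i, hi⟩ ⟨j, hj⟩}

/-- `I*`: the largest `μ`-connected subset of `I`, i.e. the union of the connected
components of `I` that meet `J_>`. -/
def muPart (μ : V) (I : Set (Fin m)) : Set (Fin m) :=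
  {j | ∃ (hj : j ∈ I) (k : Fin m) (hk : k ∈ I), S.coroot k μ ≠ 0 ∧
    (S.diagram.induce I).Reachable ⟨j, hj⟩ ⟨k, hk⟩}

/-- `I_*`: the set of `α ∈ J₀ \ I` orthogonal to all of `I`. -/
def starSet (μ : V) (I : Set (Fin m)) : Set (Fin m) :=
  {i | S.coroot i μ = 0 ∧ i ∉ I ∧ ∀ j ∈ I, S.coroot i (S.root j) = 0}

/-- A subset `K ⊆ Π` is of finite type if the subgroup `W_K` is finite. -/
def FiniteType (K : Set (Fin m)) : Prop := ((S.WI K : Subgroup (V ≃ₗ[ℝ] V)) : Set (V ≃ₗ[ℝ] V)).Finite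

/-- Every connected component of `K` is of finite type. -/
def FinTypeComponents (K : Set (Fin m)) : Prop := ∀ i ∈ K, S.FiniteType (S.comp K i)

/-- A fundamental face of `H`: a face which is empty or whose relative interior meets
the fundamental chamber. -/
def IsFundFace (μ : V) (F : Set V) : Prop :=
  IsFaceOf (S.orbitHull μ) F ∧ (F = ∅ ∨ (intrinsicInterior ℝ F ∩ S.chamber).Nonempty)

/-- The length of `w ∈ W` with respect to the fundamental reflections. -/
def len (w : V ≃ₗ[ℝ] V) : ℕ :=
  sInf {k | ∃ l : List (Fin m), l.length = k ∧ w = (l.map S.s).prod}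

end GCMRealization

end


namespace GCMRealization

section Helpers

variable {m : ℕ} {V : Type*} [NormedAddCommGroup V] [NormedSpace ℝ V]
variable (S : GCMRealization m V)

lemma s_apply (i : Fin m) (x : V) : S.s i x = x - S.coroot i x • S.root i := rfl

lemma coroot_self (i : Fin m) : S.coroot i (S.root i) = 2 := by
  rw [S.pairing, S.A_diag]; norm_num

lemma coroot_s (j i : Fin m) (x : V) :
    S.coroot j (S.s i x) = S.coroot j x - S.coroot i x * (S.A j i : ℝ) := by
  rw [s_apply, map_sub, map_smul, S.pairing, smul_eq_mul]

lemma s_mul_self (i : Fin m) : S.s i * S.s i = 1 := by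
  ext x
  simp only [LinearEquiv.mul_apply, LinearEquiv.coe_one, id]
  rw [s_apply, coroot_s, s_apply, S.A_diag]
  push_cast
  module

lemma s_s_apply (i : Fin m) (x : V) : S.s i (S.s i x) = x := by
  have := congrArg (fun e : V ≃ₗ[ℝ] V => e x) (S.s_mul_self i)
  simpa using this

lemma s_inv (i : Fin m) : (S.s i)⁻¹ = S.s i :=
  inv_eq_of_mul_eq_one_left (S.s_mul_self i)

/-- product of a word -/
def wd (l : List (Fin m)) : V ≃ₗ[ℝ] V := (l.map S.s).prod

@[simp] lemma wd_nil : S.wd [] = 1 := rfl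
@[simp] lemma wd_cons (i : Fin m) (l : List (Fin m)) : S.wd (i :: l) = S.s i * S.wd l := by
  simp [wd]
@[simp] lemma wd_append (l l' : List (Fin m)) : S.wd (l ++ l') = S.wd l * S.wd l' := by
  simp [wd]

lemma W_eq : S.W = S.WI Set.univ := by simp [W, WI]

lemma s_mem_WI {I : Set (Fin m)} {i : Fin m} (hi : i ∈ I) : S.s i ∈ S.WI I :=
  Subgroup.subset_closure ⟨i, hi, rfl⟩

lemma s_mem_W (i : Fin m) : S.s i ∈ S.W := Subgroup.subset_closure ⟨i, rfl⟩

lemma WI_mono {I I' : Set (Fin m)} (h : I ⊆ I') : S.WI I ≤ S.WI I' :=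
  Subgroup.closure_mono (Set.image_mono h)

lemma WI_le_W (I : Set (Fin m)) : S.WI I ≤ S.W := by
  rw [W_eq]; exact S.WI_mono (Set.subset_univ _)

lemma wd_mem_WI {I : Set (Fin m)} (l : List (Fin m)) (h : ∀ i ∈ l, i ∈ I) :
    S.wd l ∈ S.WI I := by
  induction l with
  | nil => exact one_mem _
  | cons a l ih =>
    rw [wd_cons]
    exact mul_mem (S.s_mem_WI (h a (by simp))) (ih fun i hi => h i (by simp [hi]))

lemma wd_mem_W (l : List (Fin m)) : S.wd l ∈ S.W := by
  rw [W_eq]; exact S.wd_mem_WI l (by simp)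

lemma exists_wd_of_mem_WI {I : Set (Fin m)} {w : V ≃ₗ[ℝ] V} (hw : w ∈ S.WI I) :
    ∃ l : List (Fin m), (∀ i ∈ l, i ∈ I) ∧ w = S.wd l := by
  refine Subgroup.closure_induction_left (p := fun w _ =>
    ∃ l : List (Fin m), (∀ i ∈ l, i ∈ I) ∧ w = S.wd l) ⟨[], by simp, rfl⟩ ?_ ?_ hw
  · rintro _ ⟨i, hi, rfl⟩ y _ ⟨l, hl, rfl⟩
    exact ⟨i :: l, by simpa using ⟨hi, hl⟩, by simp⟩
  · rintro _ ⟨i, hi, rfl⟩ y _ ⟨l, hl, rfl⟩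
    exact ⟨i :: l, by simpa using ⟨hi, hl⟩, by simp [s_inv]⟩

lemma exists_wd_of_mem_W {w : V ≃ₗ[ℝ] V} (hw : w ∈ S.W) :
    ∃ l : List (Fin m), w = S.wd l := by
  rw [W_eq] at hw
  obtain ⟨l, _, h⟩ := S.exists_wd_of_mem_WI hw
  exact ⟨l, h⟩

lemma len_wd_le (l : List (Fin m)) : S.len (S.wd l) ≤ l.length :=
  Nat.sInf_le ⟨l, rfl, rfl⟩

lemma exists_reduced {w : V ≃ₗ[ℝ] V} (hw : w ∈ S.W) :
    ∃ l : List (Fin m), l.length = S.len w ∧ w = S.wd l := by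
  obtain ⟨l, h⟩ := S.exists_wd_of_mem_W hw
  exact Nat.sInf_mem (s := {k | ∃ l : List (Fin m), l.length = k ∧ w = (l.map S.s).prod})
    ⟨l.length, l, rfl, h⟩

lemma len_wd_mul_le (l : List (Fin m)) {x : V ≃ₗ[ℝ] V} (hx : x ∈ S.W) :
    S.len (S.wd l * x) ≤ l.length + S.len x := by
  obtain ⟨l', h, rfl⟩ := S.exists_reduced hx
  rw [← h, ← wd_append]
  exact (S.len_wd_le _).trans (by simp)

lemma len_s_mul_le (i : Fin m) {x : V ≃ₗ[ℝ] V} (hx : x ∈ S.W) :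
    S.len (S.s i * x) ≤ S.len x + 1 := by
  have := S.len_wd_mul_le [i] hx
  simp at this; omega

/-- Every nontrivial element can be shortened from the left. -/
lemma exists_left_descent {w : V ≃ₗ[ℝ] V} (hw : w ∈ S.W) :
    w = 1 ∨ ∃ i v, v ∈ S.W ∧ w = S.s i * v ∧ S.len w = S.len v + 1 := by
  obtain ⟨l, hl, hw'⟩ := S.exists_reduced hw
  cases l with
  | nil => left; simpa using hw'
  | cons i l =>
    right
    refine ⟨i, S.wd l, S.wd_mem_W l, by simpa using hw', ?_⟩
    have h1 := S.len_wd_le l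
    have h2 := S.len_s_mul_le i (S.wd_mem_W l)
    have h3 : S.len w = S.len (S.s i * S.wd l) := by rw [hw', wd_cons]
    simp at hl
    omega

/-- alternating words -/
def alt (i j : Fin m) : ℕ → List (Fin m)
  | 0 => []
  | n + 1 => i :: alt j i n

@[simp] lemma alt_zero (i j : Fin m) : alt i j 0 = [] := rfl
@[simp] lemma alt_succ (i j : Fin m) (n : ℕ) : alt i j (n + 1) = i :: alt j i n := rfl
@[simp] lemma alt_length (i j : Fin m) (n : ℕ) : (alt i j n).length = n := by
  induction n generalizing i j with
  | zero => rfl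
  | succ n ih => simp [ih]

lemma eq_alt (i j : Fin m) (p : List (Fin m)) (hp : ∀ a ∈ p, a = i ∨ a = j)
    (hred : ∀ q, S.wd q = S.wd p → p.length ≤ q.length) :
    p = alt i j p.length ∨ p = alt j i p.length := by
  induction p with
  | nil => simp
  | cons a p ih =>
    have ih' := ih (fun b hb => hp b (by simp [hb])) (fun q hq => by
      have := hred (a :: q) (by simp [hq])
      simpa using this)
    have key : ∀ b t, p = b :: t → a ≠ b := by
      rintro b t rfl rfl
      have := hred t (by simp [← mul_assoc, s_mul_self])
      simp at this
    rcases hn : p.length with _ | n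
    · have : p = [] := by simpa using hn
      subst this
      rcases hp a (by simp) with rfl | rfl <;> simp
    · rw [hn] at ih'
      simp only [List.length_cons, hn]
      rcases ih' with h | h
      · have h1 := key _ _ h
        have : a = j := (hp a (by simp)).resolve_left h1
        subst this
        right; rw [h]; simp
      · have h1 := key _ _ h
        have : a = i := (hp a (by simp)).resolve_right h1
        subst this
        left; rw [h]; simp

lemma alt_invariant (n : ℕ) : ∀ (i j : Fin m), i ≠ j → 4 ≤ S.A i j * S.A j i → ∀ (x : V),
    0 ≤ S.coroot i x → 0 ≤ S.coroot j x →
    0 ≤ S.coroot j (S.wd (alt i j n) x) ∧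
    0 ≤ 2 * S.coroot i (S.wd (alt i j n) x) - (S.A i j : ℝ) * S.coroot j (S.wd (alt i j n) x) := by
  induction n with
  | zero =>
    intro i j hij _ x hi hj
    have h : (S.A i j : ℝ) ≤ 0 := by exact_mod_cast S.A_offdiag i j hij
    simp only [alt_zero, wd_nil, LinearEquiv.coe_one, id]
    refine ⟨hj, by nlinarith⟩
  | succ n ih =>
    intro i j hij h4 x hi hj
    obtain ⟨h1, h2⟩ := ih j i hij.symm (by rw [mul_comm]; exact h4) x hj hi
    have h : (S.A i j : ℝ) ≤ 0 := by exact_mod_cast S.A_offdiag i j hij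
    have h' : (S.A j i : ℝ) ≤ 0 := by exact_mod_cast S.A_offdiag j i hij.symm
    have h4' : (4 : ℝ) ≤ (S.A i j : ℝ) * S.A j i := by exact_mod_cast h4
    simp only [alt_succ, wd_cons, LinearEquiv.mul_apply, coroot_s, S.A_diag]
    set y := S.coroot j (S.wd (alt j i n) x)
    set z := S.coroot i (S.wd (alt j i n) x)
    set a := (S.A i j : ℝ)
    set b := (S.A j i : ℝ)
    push_cast
    refine ⟨by nlinarith, ?_⟩
    have e1 : 0 ≤ (a * b - 4) * z := mul_nonneg (by linarith) h1
    have e2 : 0 ≤ (-a) * (2 * y - b * z) := mul_nonneg (by linarith) h2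
    nlinarith

lemma braid_reduce {i j : Fin m} (k n : ℕ) 
    (hb : S.wd (alt i j (k + 1)) = S.wd (alt j i (k + 1)))
    (l l' : List (Fin m)) (hl : l = alt i j (k + 1) ++ l') (hn : l.length = n)
    (hred : ∀ q, S.wd q = S.s j * S.wd l → n ≤ q.length) : False := by
  subst hl
  have := hred (alt i j k ++ l') (by
    rw [wd_append, wd_append, hb, alt_succ, wd_cons]
    simp only [← mul_assoc, s_mul_self, one_mul])
  simp at this hn
  omega

lemma braid2 {i j : Fin m} (h1 : S.A i j = 0) (h2 : S.A j i = 0) :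
    S.wd (alt i j 2) = S.wd (alt j i 2) := by
  ext x
  simp only [alt_succ, alt_zero, wd_cons, wd_nil, LinearEquiv.mul_apply, LinearEquiv.coe_one, id,
    s_apply, map_sub, map_smul, S.pairing, h1, h2, S.A_diag, smul_eq_mul]
  push_cast
  module

lemma braid3 {i j : Fin m} (h1 : S.A i j = -1) (h2 : S.A j i = -1) :
    S.wd (alt i j 3) = S.wd (alt j i 3) := by
  ext x
  simp only [alt_succ, alt_zero, wd_cons, wd_nil, LinearEquiv.mul_apply, LinearEquiv.coe_one, id,
    s_apply, map_sub, map_smul, S.pairing, h1, h2, S.A_diag, smul_eq_mul]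
  push_cast
  module

lemma braid4 {i j : Fin m} (h1 : S.A i j = -1) (h2 : S.A j i = -2) :
    S.wd (alt i j 4) = S.wd (alt j i 4) := by
  ext x
  simp only [alt_succ, alt_zero, wd_cons, wd_nil, LinearEquiv.mul_apply, LinearEquiv.coe_one, id,
    s_apply, map_sub, map_smul, S.pairing, h1, h2, S.A_diag, smul_eq_mul]
  push_cast
  module

set_option maxHeartbeats 2000000 in
lemma braid6 {i j : Fin m} (h1 : S.A i j = -1) (h2 : S.A j i = -3) :
    S.wd (alt i j 6) = S.wd (alt j i 6) := by
  ext x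
  simp only [alt_succ, alt_zero, wd_cons, wd_nil, LinearEquiv.mul_apply, LinearEquiv.coe_one, id]
  have hi : ∀ c d : ℝ, S.s i (x + c • S.root i + d • S.root j) =
      x + (-c + d - S.coroot i x) • S.root i + d • S.root j := by
    intro c d
    simp only [s_apply, map_add, map_smul, S.pairing, h1, h2, S.A_diag, smul_eq_mul]
    push_cast
    module
  have hj : ∀ c d : ℝ, S.s j (x + c • S.root i + d • S.root j) =
      x + c • S.root i + (-d + 3 * c - S.coroot j x) • S.root j := by
    intro c d
    simp only [s_apply, map_add, map_smul, S.pairing, h1, h2, S.A_diag, smul_eq_mul]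
    push_cast
    module
  have hx : x = x + (0 : ℝ) • S.root i + (0 : ℝ) • S.root j := by simp
  generalize hX : x = X at hx ⊢
  rw [hx]
  subst hX
  simp only [hi, hj]
  module

lemma dihedral {i j : Fin m} (hij : i ≠ j) (p : List (Fin m)) (hp : ∀ a ∈ p, a = i ∨ a = j)
    (hred : ∀ q, S.wd q = S.wd p → p.length ≤ q.length)
    (hred' : ∀ q, S.wd q = S.s j * S.wd p → p.length ≤ q.length)
    (x : V) (hi : 0 ≤ S.coroot i x) (hj : 0 ≤ S.coroot j x) :
    0 ≤ S.coroot j (S.wd p x) := by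
  have hp' : p = alt i j p.length := by
    rcases S.eq_alt i j p hp hred with h | h
    · exact h
    · rcases hn : p.length with _ | n
      · have : p = [] := by simpa using hn
        simp [this]
      · rw [hn] at h
        have := hred' (alt i j n) (by rw [h]; simp [← mul_assoc, s_mul_self])
        simp at this
        omega
  generalize hn : p.length = n at *
  by_cases h4 : 4 ≤ S.A i j * S.A j i
  · rw [hp']
    exact (S.alt_invariant n i j hij h4 x hi hj).1
  push Not at h4
  have ha := S.A_offdiag i j hij
  have hb := S.A_offdiag j i hij.symm
  have hz := S.A_zero_iff i j
  have cases6 : (S.A i j = 0 ∧ S.A j i = 0) ∨ (S.A i j = -1 ∧ S.A j i = -1) ∨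
      (S.A i j = -1 ∧ S.A j i = -2) ∨ (S.A i j = -2 ∧ S.A j i = -1) ∨
      (S.A i j = -1 ∧ S.A j i = -3) ∨ (S.A i j = -3 ∧ S.A j i = -1) := by
    generalize S.A i j = a at *
    generalize S.A j i = b at *
    by_cases h0 : a = 0
    · left; exact ⟨h0, hz.1 h0⟩
    have h0' : b ≠ 0 := fun h => h0 (hz.2 h)
    have a1 : a ≤ -1 := by omega
    have b1 : b ≤ -1 := by omega
    have a3 : -3 ≤ a := by nlinarith
    have b3 : -3 ≤ b := by nlinarith
    interval_cases a <;> interval_cases b <;> simp_all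
  have small : ∀ k, (∃ r, S.wd (alt i j (k + 1)) = S.wd (alt j i (k + 1)) ∧ n = (k + 1) + r ∧
      p = alt i j (k + 1) ++ (p.drop (k+1))) → False := by
    rintro k ⟨r, h1, h2, h3⟩
    exact S.braid_reduce k n h1 p _ h3 hn hred'
  have split : ∀ k, S.wd (alt i j (k + 1)) = S.wd (alt j i (k + 1)) → n < k + 1 := by
    intro k hk
    by_contra hc
    push Not at hc
    obtain ⟨r, rfl⟩ := Nat.exists_eq_add_of_le hc
    refine small k ⟨r, hk, rfl, ?_⟩
    have : ∀ (k r : ℕ) (i j : Fin m), (alt i j (k + r)).take k = alt i j k := by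
      intro k r
      induction k with
      | zero => simp
      | succ k ih => intro i j; rw [Nat.succ_add]; simp [ih]
    conv_lhs => rw [← List.take_append_drop (k + 1) p]
    congr 1
    conv_lhs => rw [hp']
    rw [this]
  rw [hp']
  rcases cases6 with ⟨h1, h2⟩ | ⟨h1, h2⟩ | ⟨h1, h2⟩ | ⟨h1, h2⟩ | ⟨h1, h2⟩ | ⟨h1, h2⟩
  · have := split 1 (S.braid2 h1 h2)
    interval_cases n <;>
    · simp only [alt_succ, alt_zero, wd_cons, wd_nil, LinearEquiv.mul_apply, LinearEquiv.coe_one,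
        id, coroot_s, h1, h2, S.A_diag]
      push_cast
      linarith
  · have := split 2 (S.braid3 h1 h2)
    interval_cases n <;>
    · simp only [alt_succ, alt_zero, wd_cons, wd_nil, LinearEquiv.mul_apply, LinearEquiv.coe_one,
        id, coroot_s, h1, h2, S.A_diag]
      push_cast
      linarith
  · have := split 3 (S.braid4 h1 h2)
    interval_cases n <;>
    · simp only [alt_succ, alt_zero, wd_cons, wd_nil, LinearEquiv.mul_apply, LinearEquiv.coe_one,
        id, coroot_s, h1, h2, S.A_diag]
      push_cast
      linarith
  · have := split 3 (S.braid4 h2 h1).symm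
    interval_cases n <;>
    · simp only [alt_succ, alt_zero, wd_cons, wd_nil, LinearEquiv.mul_apply, LinearEquiv.coe_one,
        id, coroot_s, h1, h2, S.A_diag]
      push_cast
      linarith
  · have := split 5 (S.braid6 h1 h2)
    interval_cases n <;>
    · simp only [alt_succ, alt_zero, wd_cons, wd_nil, LinearEquiv.mul_apply, LinearEquiv.coe_one,
        id, coroot_s, h1, h2, S.A_diag]
      push_cast
      linarith
  · have := split 5 (S.braid6 h2 h1).symm
    interval_cases n <;>
    · simp only [alt_succ, alt_zero, wd_cons, wd_nil, LinearEquiv.mul_apply, LinearEquiv.coe_one,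
        id, coroot_s, h1, h2, S.A_diag]
      push_cast
      linarith

/-- Tits' lemma. -/
lemma tits (n : ℕ) : ∀ (v : V ≃ₗ[ℝ] V), v ∈ S.W → S.len v = n → ∀ j,
    S.len v ≤ S.len (S.s j * v) → ∀ x ∈ S.chamber, 0 ≤ S.coroot j (v x) := by
  induction n using Nat.strong_induction_on with
  | _ n ih =>
  intro v hv hn j hj x hx
  rcases S.exists_left_descent hv with rfl | ⟨i, v', hv', hvv', hlen⟩
  · simpa using hx j
  have hij : i ≠ j := by
    rintro rfl
    rw [hvv', ← mul_assoc, s_mul_self, one_mul, ← hvv'] at hj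
    omega
  classical
  let P : ℕ → Prop := fun k => ∃ p : List (Fin m), (∀ a ∈ p, a = i ∨ a = j) ∧ ∃ y ∈ S.W,
    S.len y = k ∧ v = S.wd p * y ∧ p.length + S.len y = S.len v
  have hP : P (S.len v') := ⟨[i], by simp, v', hv', rfl, by simpa using hvv', by simp; omega⟩
  have hex : ∃ k, P k := ⟨_, hP⟩
  obtain ⟨p, hp, y, hy, hyk, hvy, hpy⟩ := Nat.find_spec hex
  have hmin : ∀ k, P k → S.len y ≤ k := fun k hk => hyk ▸ Nat.find_min' hex hk
  have hylt : S.len y < n := by have := hmin _ hP; omega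
  have hdom : ∀ a, (a = i ∨ a = j) → 0 ≤ S.coroot a (y x) := by
    intro a ha
    refine ih _ hylt y hy rfl a ?_ x hx
    by_contra hc
    push Not at hc
    have hay : S.s a * y ∈ S.W := mul_mem (S.s_mem_W a) hy
    have hvay : v = S.wd (p ++ [a]) * (S.s a * y) := by
      rw [hvy]
      simp only [wd_append, wd_cons, wd_nil, mul_one]
      rw [mul_assoc, ← mul_assoc (S.s a), s_mul_self, one_mul]
    have h1 : S.len v ≤ (p ++ [a]).length + S.len (S.s a * y) := by
      conv_lhs => rw [hvay]
      exact S.len_wd_mul_le _ hay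
    simp at h1
    have : P (S.len (S.s a * y)) := by
      refine ⟨p ++ [a], ?_, _, hay, rfl, hvay, ?_⟩
      · intro b hb
        simp at hb
        rcases hb with hb | rfl
        · exact hp b hb
        · exact ha
      · simp; omega
    have := hmin _ this
    omega
  rw [hvy, LinearEquiv.mul_apply]
  refine S.dihedral hij p hp ?_ ?_ (y x) (hdom i (Or.inl rfl)) (hdom j (Or.inr rfl))
  · intro q hq
    have := S.len_wd_mul_le q hy
    rw [hq, ← hvy] at this
    omega
  · intro q hq
    have := S.len_wd_mul_le q hy
    rw [hq, mul_assoc, ← hvy] at this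
    omega

lemma exists_functional {U : Type*} [AddCommGroup U] [Module ℝ U] {b : Fin m → U}
    (hb : LinearIndependent ℝ b) (c : Fin m → ℝ) : ∃ f : U →ₗ[ℝ] ℝ, ∀ i, f (b i) = c i := by
  obtain ⟨g, hg⟩ := LinearMap.exists_extend ((Module.Basis.span hb).constr ℝ c)
  refine ⟨g, fun i => ?_⟩
  have h1 := congrArg (fun h => h (Module.Basis.span hb i)) hg
  simp only [Module.Basis.constr_basis] at h1
  rw [← h1, LinearMap.comp_apply, Submodule.subtype_apply, Module.Basis.span_apply]

lemma exists_point (c : Fin m → ℝ) : ∃ x : V, ∀ i, S.coroot i x = c i := by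
  have := S.finDim
  obtain ⟨F, hF⟩ := exists_functional S.coroot_indep c
  refine ⟨(Module.evalEquiv ℝ V).symm F, fun i => ?_⟩
  rw [← hF i]
  exact Module.apply_evalEquiv_symm_apply (R := ℝ) (M := V) (S.coroot i) F

lemma coroot_int (l : List (Fin m)) : ∀ j, ∃ n : Fin m → ℤ, ∀ x,
    S.coroot j (S.wd l x) = ∑ k, (n k : ℝ) * S.coroot k x := by
  induction l with
  | nil =>
    intro j
    refine ⟨Pi.single j 1, fun x => ?_⟩
    rw [Finset.sum_eq_single j]
    · simp
    · intro b _ hb; simp [hb]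
    · simp
  | cons i l ih =>
    intro j
    obtain ⟨n, hn⟩ := ih j
    obtain ⟨n', hn'⟩ := ih i
    refine ⟨fun k => n k - n' k * S.A j i, fun x => ?_⟩
    rw [wd_cons, LinearEquiv.mul_apply, coroot_s, hn, hn', Finset.sum_mul, ← Finset.sum_sub_distrib]
    refine Finset.sum_congr rfl fun k _ => ?_
    push_cast
    ring

lemma coroot_nat {v : V ≃ₗ[ℝ] V} (hv : v ∈ S.W) (j : Fin m)
    (hj : S.len v ≤ S.len (S.s j * v)) : ∃ n : Fin m → ℕ, ∀ x,
    S.coroot j (v x) = ∑ k, (n k : ℝ) * S.coroot k x := by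
  obtain ⟨l, rfl⟩ := S.exists_wd_of_mem_W hv
  obtain ⟨n, hn⟩ := S.coroot_int l j
  have hpos : ∀ k, 0 ≤ n k := by
    intro k
    obtain ⟨x, hx⟩ := S.exists_point (Pi.single k 1)
    have h1 := S.tits _ _ hv rfl j hj x (by
      intro i
      rw [hx]
      by_cases h : i = k
      · subst h; simp
      · simp [h])
    rw [hn, Finset.sum_eq_single k] at h1
    · rw [hx] at h1
      simpa using h1
    · intro b _ hb
      rw [hx]; simp [hb]
    · simp
  refine ⟨fun k => (n k).toNat, fun x => ?_⟩
  rw [hn]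
  refine Finset.sum_congr rfl fun k _ => ?_
  congr 1
  have := Int.toNat_of_nonneg (hpos k)
  exact_mod_cast this.symm

/-- `μ - w μ` is a nonnegative combination of roots, with quantized coefficients. -/
lemma sub_eq (n : ℕ) : ∀ w ∈ S.W, S.len w = n → ∃ N : Fin m → Fin m → ℕ, ∀ x : V,
    x - w x = ∑ i, (∑ k, (N i k : ℝ) * S.coroot k x) • S.root i := by
  induction n with
  | zero =>
    intro w hw hn
    rcases S.exists_left_descent hw with rfl | ⟨i, v, hv, rfl, hl⟩
    · exact ⟨0, by simp⟩
    · omega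
  | succ n ih =>
    intro w hw hn
    rcases S.exists_left_descent hw with rfl | ⟨i, v, hv, rfl, hl⟩
    · exact ⟨0, by simp⟩
    · obtain ⟨N, hN⟩ := ih v hv (by omega)
      obtain ⟨c, hc⟩ := S.coroot_nat hv i (by omega)
      classical
      refine ⟨fun a k => N a k + if a = i then c k else 0, fun x => ?_⟩
      have h1 : x - (S.s i * v) x = (x - v x) + S.coroot i (v x) • S.root i := by
        rw [LinearEquiv.mul_apply, s_apply]; abel
      rw [h1, hN, hc]
      have h2 : (∑ k, (c k : ℝ) * S.coroot k x) • S.root i =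
          ∑ a, (if a = i then (∑ k, (c k : ℝ) * S.coroot k x) else 0) • S.root a := by
        simp only [ite_smul, zero_smul, Finset.sum_ite_eq', Finset.mem_univ, if_true]
      rw [h2, ← Finset.sum_add_distrib]
      refine Finset.sum_congr rfl fun a _ => ?_
      rw [← add_smul]
      congr 1
      by_cases h : a = i
      · simp [h, add_mul, Finset.sum_add_distrib]
      · simp [h]

lemma functional_le {μ : V} (hμ : μ ∈ S.chamber) (f : V →ₗ[ℝ] ℝ) (hf : ∀ i, 0 ≤ f (S.root i))
    {w : V ≃ₗ[ℝ] V} (hw : w ∈ S.W) : f (w μ) ≤ f μ := by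
  obtain ⟨N, hN⟩ := S.sub_eq _ w hw rfl
  have := congrArg f (hN μ)
  rw [map_sub, map_sum] at this
  have h2 : 0 ≤ ∑ i, f ((∑ k, (N i k : ℝ) * S.coroot k μ) • S.root i) := by
    refine Finset.sum_nonneg fun i _ => ?_
    rw [map_smul, smul_eq_mul]
    exact mul_nonneg (Finset.sum_nonneg fun k _ => mul_nonneg (by positivity) (hμ k)) (hf i)
  linarith

lemma functional_eq {μ : V} (hμ : μ ∈ S.chamber) (f : V →ₗ[ℝ] ℝ) (I : Set (Fin m))
    (hf : ∀ i, 0 ≤ f (S.root i)) (hf0 : ∀ i, f (S.root i) = 0 → i ∈ I) (n : ℕ) :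
    ∀ w ∈ S.W, S.len w = n → f (w μ) = f μ → w μ ∈ orbitOf (S.WI I) μ := by
  induction n with
  | zero =>
    intro w hw hn hfw
    rcases S.exists_left_descent hw with rfl | ⟨i, v, hv, rfl, hl⟩
    · exact ⟨1, one_mem _, rfl⟩
    · omega
  | succ n ih =>
    intro w hw hn hfw
    rcases S.exists_left_descent hw with rfl | ⟨i, v, hv, rfl, hl⟩
    · exact ⟨1, one_mem _, rfl⟩
    · have hd := S.tits _ v hv rfl i (by omega) μ hμ
      have h1 := S.functional_le hμ f hf hv
      have h2 : (S.s i * v) μ = v μ - S.coroot i (v μ) • S.root i := by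
        rw [LinearEquiv.mul_apply, s_apply]
      have h3 := congrArg f h2
      rw [map_sub, map_smul, smul_eq_mul, hfw] at h3
      have h4 := mul_nonneg hd (hf i)
      have h5 : S.coroot i (v μ) * f (S.root i) = 0 := by linarith
      obtain ⟨u, hu, huv⟩ := ih v hv (by omega) (by linarith)
      rcases mul_eq_zero.1 h5 with h | h
      · rw [h2, h]
        exact ⟨u, hu, by simpa using huv⟩
      · refine ⟨S.s i * u, mul_mem (S.s_mem_WI (hf0 i h)) hu, ?_⟩
        simp only [LinearEquiv.mul_apply] at huv ⊢
        rw [huv]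

lemma dominant_unique {μ : V} (hμ : μ ∈ S.chamber) {w : V ≃ₗ[ℝ] V} (hw : w ∈ S.W)
    (hd : w μ ∈ S.chamber) : w μ = μ := by
  obtain ⟨f, hf⟩ := exists_functional S.root_indep (fun _ => 1)
  have hf' : ∀ i, 0 ≤ f (S.root i) := fun i => by rw [hf]; norm_num
  have h1 := S.functional_le hμ f hf' hw
  have h2 := S.functional_le hd f hf' (inv_mem hw)
  have h3 : (w⁻¹) (w μ) = μ := by rw [← LinearEquiv.mul_apply]; simp
  rw [h3] at h2
  obtain ⟨u, hu, hu'⟩ := S.functional_eq hμ f ∅ hf' (fun i hi => by rw [hf] at hi; norm_num at hi)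
    _ w hw rfl (le_antisymm h1 h2)
  have : u = 1 := by simpa [WI] using hu
  subst this
  exact hu'.symm

lemma orbit_stable {G : Subgroup (V ≃ₗ[ℝ] V)} {u : V ≃ₗ[ℝ] V} (hu : u ∈ G) (μ : V) :
    u '' (convexHull ℝ (orbitOf G μ)) = convexHull ℝ (orbitOf G μ) := by
  have h := u.toLinearMap.image_convexHull (orbitOf G μ)
  have h2 : u '' (orbitOf G μ) = orbitOf G μ := by
    ext y
    constructor
    · rintro ⟨_, ⟨w, hw, rfl⟩, rfl⟩
      exact ⟨u * w, mul_mem hu hw, rfl⟩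
    · rintro ⟨w, hw, rfl⟩
      refine ⟨(u⁻¹ * w) μ, ⟨u⁻¹ * w, mul_mem (inv_mem hu) hw, rfl⟩, ?_⟩
      rw [← LinearEquiv.mul_apply]; simp
  simp only [LinearEquiv.coe_coe] at h
  rw [h, h2]

lemma orbitHull_mem {μ : V} {u : V ≃ₗ[ℝ] V} (hu : u ∈ S.W) {x : V} (hx : x ∈ S.orbitHull μ) :
    u x ∈ S.orbitHull μ := by
  have := orbit_stable hu μ
  unfold orbitHull at *
  rw [← this]
  exact ⟨x, hx, rfl⟩

/-- height values are discrete -/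
lemma height_discrete {μ : V} (hμ : μ ∈ S.chamber) (f : V →ₗ[ℝ] ℝ) (hf : ∀ i, f (S.root i) = 1)
    {x : V} (hx : x ∈ S.orbitHull μ) : ∃ T : Set ℝ, T.Finite ∧ (∀ t ∈ T, 0 ≤ t) ∧
      ∀ w ∈ S.W, f μ - f (w x) ∈ AddSubmonoid.closure T := by
  let Q : Set V := {x | ∃ T : Set ℝ, T.Finite ∧ (∀ t ∈ T, 0 ≤ t) ∧
      ∀ w ∈ S.W, f μ - f (w x) ∈ AddSubmonoid.closure T}
  have : S.orbitHull μ ⊆ Q := by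
    refine convexHull_min ?_ ?_
    · rintro _ ⟨v, hv, rfl⟩
      refine ⟨Set.range fun k => S.coroot k μ, Set.finite_range _, ?_, ?_⟩
      · rintro _ ⟨k, rfl⟩; exact hμ k
      · intro w hw
        obtain ⟨N, hN⟩ := S.sub_eq _ (w * v) (mul_mem hw hv) rfl
        have h := congrArg f (hN μ)
        rw [map_sub, map_sum] at h
        simp only [LinearEquiv.mul_apply] at h
        simp only
        rw [h]
        refine sum_mem fun i _ => ?_
        rw [map_smul, hf, smul_eq_mul, mul_one]
        refine sum_mem fun k _ => ?_
        rw [← nsmul_eq_mul]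
        exact nsmul_mem (AddSubmonoid.subset_closure (Set.mem_range_self k)) _
    · rintro y ⟨T, hT, hT0, hTw⟩ z ⟨T', hT', hT0', hTw'⟩ a b ha hb hab
      refine ⟨(fun t => a * t) '' T ∪ (fun t => b * t) '' T', (hT.image _).union (hT'.image _),
        ?_, ?_⟩
      · rintro _ (⟨t, ht, rfl⟩ | ⟨t, ht, rfl⟩)
        · exact mul_nonneg ha (hT0 t ht)
        · exact mul_nonneg hb (hT0' t ht)
      · intro w hw
        have e : f μ - f (w (a • y + b • z)) = a * (f μ - f (w y)) + b * (f μ - f (w z)) := by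
          simp only [map_add, map_smul, smul_eq_mul]
          have : f μ = (a + b) * f μ := by rw [hab, one_mul]
          linear_combination this
        rw [e]
        have key : ∀ (a : ℝ) (T U : Set ℝ), (fun t => a * t) '' T ⊆ U → ∀ r,
            r ∈ AddSubmonoid.closure T → a * r ∈ AddSubmonoid.closure U := by
          intro a T U hU r hr
          induction hr using AddSubmonoid.closure_induction with
          | mem x hx => exact AddSubmonoid.subset_closure (hU ⟨x, hx, rfl⟩)
          | zero => simp
          | add x y _ _ h1 h2 => rw [mul_add]; exact add_mem h1 h2
        exact add_mem (key a T _ Set.subset_union_left _ (hTw w hw))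
          (key b T' _ Set.subset_union_right _ (hTw' w hw))
  exact this hx

/-- every point of the hull can be made `I`-dominant by `W_I`. -/
lemma exists_dominant {μ : V} (hμ : μ ∈ S.chamber) (I : Set (Fin m)) {x : V}
    (hx : x ∈ S.orbitHull μ) : ∃ u ∈ S.WI I, ∀ i ∈ I, 0 ≤ S.coroot i (u x) := by
  obtain ⟨f, hf⟩ := exists_functional S.root_indep (fun _ => 1)
  obtain ⟨T, hT, hT0, hTw⟩ := S.height_discrete hμ f hf hx
  have hwf : (AddSubmonoid.closure T : Set ℝ).IsWF :=
    (Set.IsPWO.addSubmonoid_closure hT0 hT.isPWO).isWF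
  let Z : Set ℝ := (fun w : V ≃ₗ[ℝ] V => f μ - f (w x)) '' (S.WI I : Set (V ≃ₗ[ℝ] V))
  have hZ : Z.IsWF := hwf.mono (by
    rintro _ ⟨w, hw, rfl⟩
    exact hTw w (S.WI_le_W I hw))
  have hZn : Z.Nonempty := ⟨_, 1, one_mem _, rfl⟩
  obtain ⟨u, hu, hue⟩ := hZ.min_mem hZn
  refine ⟨u, hu, fun i hi => ?_⟩
  have h1 := hZ.min_le hZn (a := f μ - f ((S.s i * u) x))
    ⟨S.s i * u, mul_mem (S.s_mem_WI hi) hu, rfl⟩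
  simp only at hue
  rw [← hue, LinearEquiv.mul_apply, s_apply, map_sub, map_smul, hf] at h1
  simp only [smul_eq_mul, mul_one] at h1
  linarith

lemma extreme_hull {s F : Set V} (hc : Convex ℝ F) (hF : IsExtreme ℝ (convexHull ℝ s) F) :
    F = convexHull ℝ (F ∩ s) := by
  apply Set.Subset.antisymm
  · have : convexHull ℝ s ⊆ {y | y ∈ convexHull ℝ s ∧ (y ∈ F → y ∈ convexHull ℝ (F ∩ s))} := by
      refine convexHull_min (fun y hy => ⟨subset_convexHull ℝ s hy,
        fun h => subset_convexHull ℝ _ ⟨h, hy⟩⟩) ?_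
      refine convex_iff_openSegment_subset.2 ?_
      rintro y ⟨hy, hy'⟩ z ⟨hz, hz'⟩ p hp
      refine ⟨(convex_convexHull ℝ s).openSegment_subset hy hz hp, fun hpF => ?_⟩
      have h1 := hF.left_mem_of_mem_openSegment hy hz hpF hp
      have h2 := hF.right_mem_of_mem_openSegment hy hz hpF hp
      exact (convex_convexHull ℝ _).openSegment_subset (hy' h1) (hz' h2) hp
    exact fun y hy => (this (hF.subset hy)).2 hy
  · exact convexHull_min Set.inter_subset_left hc

lemma interior_dir {F : Set V} {x v : V} (hx : x ∈ intrinsicInterior ℝ F)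
    (hv : v ∈ vectorSpan ℝ F) : ∃ ε : ℝ, 0 < ε ∧ x + ε • v ∈ F := by
  obtain ⟨p, hp, rfl⟩ := mem_intrinsicInterior.1 hx
  have hv' : v ∈ (affineSpan ℝ F).direction := by rwa [direction_affineSpan]
  let g : ℝ → affineSpan ℝ F := fun t => ⟨(p : V) + t • v, by
    rw [add_comm]
    exact AffineSubspace.vadd_mem_of_mem_direction (Submodule.smul_mem _ t hv') p.2⟩
  have hg : Continuous g := by
    apply Continuous.subtype_mk
    fun_prop
  have hg0 : g 0 = p := by ext; simp [g]
  have h1 : ∀ᶠ t in nhds (0 : ℝ), g t ∈ ((↑) ⁻¹' F : Set (affineSpan ℝ F)) := by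
    apply hg.continuousAt.eventually_mem
    rw [hg0]
    exact mem_interior_iff_mem_nhds.1 hp
  obtain ⟨δ, hδ, hball⟩ := Metric.eventually_nhds_iff.1 h1
  refine ⟨δ / 2, by positivity, ?_⟩
  exact hball (by rw [Real.dist_eq, sub_zero, abs_of_pos (by positivity)]; linarith)

lemma face_isFace {μ : V} (hμ : μ ∈ S.chamber) (I : Set (Fin m)) :
    IsFaceOf (S.orbitHull μ) (S.face μ I) := by
  classical
  obtain ⟨f, hf⟩ := exists_functional S.root_indep (fun i => if i ∈ I then (0 : ℝ) else 1)
  have hf' : ∀ i, 0 ≤ f (S.root i) := fun i => by rw [hf]; split_ifs <;> norm_num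
  have hf0 : ∀ i, f (S.root i) = 0 → i ∈ I := by
    intro i hi
    by_contra h
    rw [hf] at hi
    simp [h] at hi
  have hle : ∀ y ∈ S.orbitHull μ, f y ≤ f μ := by
    intro y hy
    have : S.orbitHull μ ⊆ {y | f y ≤ f μ} := by
      refine convexHull_min ?_ (convex_halfSpace_le f.isLinear _)
      rintro _ ⟨w, hw, rfl⟩
      exact S.functional_le hμ f hf' hw
    exact this hy
  let G : Set V := {y | y ∈ S.orbitHull μ ∧ f y = f μ}
  have hGc : Convex ℝ G := (convex_convexHull ℝ _).inter (convex_hyperplane f.isLinear _)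
  have hGe : IsExtreme ℝ (S.orbitHull μ) G := by
    refine ⟨fun y hy => hy.1, ?_⟩
    rintro y hy z hz p ⟨hp, hfp⟩ ⟨a, b, ha, hb, hab, rfl⟩
    refine ⟨hy, ?_⟩
    have h1 := hle y hy
    have h2 := hle z hz
    simp only [map_add, map_smul, smul_eq_mul] at hfp
    have h3 : f μ = a * f μ + b * f μ := by rw [← add_mul, hab, one_mul]
    by_contra hne
    have h4 : f y < f μ := lt_of_le_of_ne h1 hne
    have h5 := mul_lt_mul_of_pos_left h4 ha
    have h6 := mul_le_mul_of_nonneg_left h2 hb.le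
    linarith
  have hG : G = S.face μ I := by
    rw [extreme_hull hGc hGe, face]
    congr 1
    ext y
    constructor
    · rintro ⟨⟨hy, hfy⟩, w, hw, rfl⟩
      exact S.functional_eq hμ f I hf' hf0 _ w hw rfl hfy
    · rintro ⟨w, hw, rfl⟩
      have hwW := S.WI_le_W I hw
      refine ⟨⟨subset_convexHull ℝ _ ⟨w, hwW, rfl⟩, ?_⟩, ⟨w, hwW, rfl⟩⟩
      obtain ⟨l, hl, rfl⟩ := S.exists_wd_of_mem_WI hw
      simp only
      clear hw hwW
      induction l with
      | nil => simp
      | cons a l ih =>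
        rw [wd_cons, LinearEquiv.mul_apply, s_apply, map_sub, map_smul, hf, if_pos (hl a (by simp))]
        simp [ih fun i hi => hl i (by simp [hi])]
  rw [← hG]
  exact ⟨hGc, hGe⟩

lemma orbit_sub_mem {I : Set (Fin m)} {μ y : V} (hy : y ∈ orbitOf (S.WI I) μ) :
    y - μ ∈ Submodule.span ℝ (S.root '' I) := by
  obtain ⟨w, hw, rfl⟩ := hy
  obtain ⟨l, hl, rfl⟩ := S.exists_wd_of_mem_WI hw
  clear hw
  simp only
  induction l with
  | nil => simp
  | cons a l ih =>
    rw [wd_cons, LinearEquiv.mul_apply, s_apply, sub_right_comm]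
    refine Submodule.sub_mem _ (ih fun i hi => hl i (by simp [hi])) ?_
    exact Submodule.smul_mem _ _ (Submodule.subset_span ⟨a, hl a (by simp), rfl⟩)

lemma face_sub_mem {I : Set (Fin m)} {μ y : V} (hy : y ∈ S.face μ I) :
    y - μ ∈ Submodule.span ℝ (S.root '' I) := by
  have : S.face μ I ⊆ {y | y - μ ∈ Submodule.span ℝ (S.root '' I)} := by
    refine convexHull_min (fun y hy => S.orbit_sub_mem hy) ?_
    intro y hy z hz a b ha hb hab
    have : a • y + b • z - μ = a • (y - μ) + b • (z - μ) := by
      have h : μ = (a + b) • μ := by rw [hab, one_smul]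
      conv_lhs => rw [h]
      module
    simp only [Set.mem_ofPred_eq]
    rw [this]
    exact Submodule.add_mem _ (Submodule.smul_mem _ _ hy) (Submodule.smul_mem _ _ hz)
  exact this hy

lemma mu_mem_face (I : Set (Fin m)) (μ : V) : μ ∈ S.face μ I :=
  subset_convexHull ℝ _ ⟨1, one_mem _, rfl⟩

lemma face_mono {I I' : Set (Fin m)} (h : I ⊆ I') (μ : V) : S.face μ I ⊆ S.face μ I' := by
  refine convexHull_mono ?_
  rintro _ ⟨w, hw, rfl⟩
  exact ⟨w, S.WI_mono h hw, rfl⟩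

lemma face_fund {μ : V} (hμ : μ ∈ S.chamber) (I : Set (Fin m)) :
    S.IsFundFace μ (S.face μ I) := by
  have := S.finDim
  refine ⟨S.face_isFace hμ I, Or.inr ?_⟩
  obtain ⟨x, hx⟩ := (Set.Nonempty.intrinsicInterior (convex_convexHull ℝ (orbitOf (S.WI I) μ))
    ⟨μ, S.mu_mem_face I μ⟩)
  have hxF : x ∈ S.face μ I := intrinsicInterior_subset hx
  obtain ⟨u, hu, hd⟩ := S.exists_dominant hμ I ((S.face_isFace hμ I).2.subset hxF)
  have himg := u.toAffineEquiv.intrinsicInterior_image (S.face μ I)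
  have hst := orbit_stable hu μ
  have hux : u x ∈ intrinsicInterior ℝ (S.face μ I) := by
    have : u.toAffineEquiv '' (S.face μ I) = S.face μ I := hst
    rw [this] at himg
    rw [himg]
    exact ⟨x, hx, rfl⟩
  refine ⟨u x, hux, fun j => ?_⟩
  by_cases hj : j ∈ I
  · exact hd j hj
  obtain ⟨g, hg⟩ : ∃ g : V, g ∈ S.face μ I ∧ g = u x := ⟨u x, intrinsicInterior_subset hux, rfl⟩
  rw [← hg.2]
  -- on the face, the `j` coordinate is at least that of `μ`
  have : S.face μ I ⊆ {y | 0 ≤ S.coroot j y} := by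
    refine convexHull_min ?_ (convex_halfSpace_ge (S.coroot j).isLinear _)
    rintro _ ⟨w, hw, rfl⟩
    classical
    obtain ⟨N, hN⟩ := S.sub_eq _ w (S.WI_le_W I hw) rfl
    obtain ⟨f, hf⟩ := exists_functional S.root_indep (fun i => if i = j then (1 : ℝ) else 0)
    have hN := hN μ
    set c : Fin m → ℝ := fun i => ∑ k, (N i k : ℝ) * S.coroot k μ with hc
    have hc0 : ∀ i, 0 ≤ c i := fun i =>
      Finset.sum_nonneg fun k _ => mul_nonneg (by positivity) (hμ k)
    change μ - w μ = ∑ i, c i • S.root i at hN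
    have hfj : f (μ - w μ) = c j := by
      rw [hN, map_sum, Finset.sum_eq_single j]
      · rw [map_smul, hf, if_pos rfl, smul_eq_mul, mul_one]
      · intro b _ hb; rw [map_smul, hf, if_neg hb, smul_zero]
      · simp
    have hker : Submodule.span ℝ (S.root '' I) ≤ LinearMap.ker f := by
      rw [Submodule.span_le]
      rintro _ ⟨i, hi, rfl⟩
      have : i ≠ j := fun h => hj (h ▸ hi)
      simp [hf, this]
    have h0 : f (w μ - μ) = 0 := hker (S.orbit_sub_mem ⟨w, hw, rfl⟩)
    have hcj : c j = 0 := by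
      rw [← hfj, ← neg_sub, map_neg, h0, neg_zero]
    have h2 := congrArg (S.coroot j) hN
    rw [map_sub, map_sum] at h2
    have h3 : ∑ i, S.coroot j (c i • S.root i) ≤ 0 := by
      refine Finset.sum_nonpos fun i _ => ?_
      rw [map_smul, S.pairing, smul_eq_mul]
      by_cases hij : i = j
      · rw [hij, hcj, zero_mul]
      · exact mul_nonpos_of_nonneg_of_nonpos (hc0 i)
          (by exact_mod_cast S.A_offdiag j i (Ne.symm hij))
    have h4 := hμ j
    change 0 ≤ S.coroot j (w μ)
    linarith
  exact this hg.1

lemma face_subset_imp {μ : V} {I I' : Set (Fin m)} (hI : S.MuConnected μ I)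
    (h : S.face μ I ⊆ S.face μ I') : I ⊆ I' := by
  set D := vectorSpan ℝ (orbitOf (S.WI I) μ) with hD
  have hDE : D ≤ Submodule.span ℝ (S.root '' I') := by
    rw [hD, vectorSpan_def, Submodule.span_le]
    rintro _ ⟨y, hy, z, hz, rfl⟩
    have h1 := S.face_sub_mem (h (subset_convexHull ℝ _ hy))
    have h2 := S.face_sub_mem (h (subset_convexHull ℝ _ hz))
    have := Submodule.sub_mem _ h1 h2
    simpa using this
  have hstab : ∀ i ∈ I, ∀ v ∈ D, S.s i v ∈ D := by
    intro i hi
    have : D ≤ D.comap (S.s i).toLinearMap := by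
      conv_lhs => rw [hD, vectorSpan_def]
      rw [Submodule.span_le]
      rintro _ ⟨_, ⟨w, hw, rfl⟩, _, ⟨w', hw', rfl⟩, rfl⟩
      simp only [vsub_eq_sub, SetLike.mem_coe, Submodule.mem_comap, map_sub, LinearEquiv.coe_coe]
      rw [← vsub_eq_sub]
      exact vsub_mem_vectorSpan ℝ ⟨S.s i * w, mul_mem (S.s_mem_WI hi) hw, rfl⟩
        ⟨S.s i * w', mul_mem (S.s_mem_WI hi) hw', rfl⟩
    exact this
  have hbase : ∀ j ∈ I, S.coroot j μ ≠ 0 → S.root j ∈ D := by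
    intro j hj hne
    have h1 : μ -ᵥ S.s j μ ∈ D := vsub_mem_vectorSpan ℝ ⟨1, one_mem _, rfl⟩
      ⟨S.s j, S.s_mem_WI hj, rfl⟩
    rw [vsub_eq_sub, s_apply, sub_sub_cancel] at h1
    exact (Submodule.smul_mem_iff _ hne).1 h1
  have hstep : ∀ a b : I, (S.diagram.induce I).Adj a b → S.root b ∈ D → S.root a ∈ D := by
    intro a b hab hb
    have hadj : S.Adjacent a b := hab
    have h1 := Submodule.sub_mem _ hb (hstab a a.2 _ hb)
    rw [s_apply, sub_sub_cancel, S.pairing] at h1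
    exact (Submodule.smul_mem_iff _ (by exact_mod_cast hadj.2.1)).1 h1
  have hreach : ∀ a b : I, (S.diagram.induce I).Reachable a b → S.root b ∈ D → S.root a ∈ D := by
    rintro a b ⟨p⟩ hb
    induction p with
    | nil => exact hb
    | cons hab _ ih => exact hstep _ _ hab (ih hb)
  intro i hi
  obtain ⟨j, hj, hr⟩ := hI ⟨i, hi⟩
  have h1 := hDE (hreach _ _ hr (hbase j j.2 hj))
  by_contra hc
  exact S.root_indep.notMem_span_image hc h1

lemma muPart_connected (μ : V) (K : Set (Fin m)) : S.MuConnected μ (S.muPart μ K) := by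
  have key : ∀ a b : K, (S.diagram.induce K).Walk a b → S.coroot (b : Fin m) μ ≠ 0 →
      ∃ (ha : (a : Fin m) ∈ S.muPart μ K) (hb : (b : Fin m) ∈ S.muPart μ K),
        (S.diagram.induce (S.muPart μ K)).Reachable ⟨a, ha⟩ ⟨b, hb⟩ := by
    intro a b p hb
    induction p with
    | @nil u =>
      have hu : (u : Fin m) ∈ S.muPart μ K := ⟨u.2, u, u.2, hb, SimpleGraph.Reachable.refl _⟩
      exact ⟨hu, hu, SimpleGraph.Reachable.refl _⟩
    | @cons u v w huv q ih =>
      obtain ⟨hv, hw, hr⟩ := ih hb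
      have hu : (u : Fin m) ∈ S.muPart μ K :=
        ⟨u.2, w, w.2, hb, ⟨SimpleGraph.Walk.cons huv q⟩⟩
      refine ⟨hu, hw, SimpleGraph.Reachable.trans (SimpleGraph.Adj.reachable ?_) hr⟩
      exact huv
  rintro ⟨i, hi, k, hk, hne, ⟨p⟩⟩
  obtain ⟨_, hb, hr⟩ := key _ _ p hne
  exact ⟨⟨k, hb⟩, hne, hr⟩

lemma face_muPart (μ : V) (K : Set (Fin m)) : S.face μ K = S.face μ (S.muPart μ K) := by
  have hsub : S.muPart μ K ⊆ K := fun i hi => hi.1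
  apply Set.Subset.antisymm
  · refine convexHull_mono ?_
    rintro _ ⟨w, hw, rfl⟩
    obtain ⟨l, hl, rfl⟩ := S.exists_wd_of_mem_WI hw
    clear hw
    simp only
    induction l with
    | nil => exact ⟨1, one_mem _, rfl⟩
    | cons i l ih =>
      obtain ⟨u, hu, hul⟩ := ih fun i hi => hl i (by simp [hi])
      have hiK := hl i (by simp)
      simp only at hul
      rw [wd_cons, LinearEquiv.mul_apply, ← hul]
      by_cases hi : i ∈ S.muPart μ K
      · exact ⟨S.s i * u, mul_mem (S.s_mem_WI hi) hu, rfl⟩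
      · have h0 : S.coroot i μ = 0 := by
          by_contra h
          exact hi ⟨hiK, i, hiK, h, SimpleGraph.Reachable.refl _⟩
        have hker : Submodule.span ℝ (S.root '' S.muPart μ K) ≤ LinearMap.ker (S.coroot i) := by
          rw [Submodule.span_le]
          rintro _ ⟨j, hj, rfl⟩
          simp only [SetLike.mem_coe, LinearMap.mem_ker, S.pairing]
          by_contra hne
          have hne' : S.A i j ≠ 0 := by exact_mod_cast hne
          have hij : i ≠ j := by rintro rfl; exact hi hj
          obtain ⟨hjK, k, hk, hkne, hr⟩ := hj
          refine hi ⟨hiK, k, hk, hkne, SimpleGraph.Reachable.trans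
            (SimpleGraph.Adj.reachable (v := ⟨j, hjK⟩) ?_) hr⟩
          exact ⟨hij, hne', fun h => hne' ((S.A_zero_iff i j).2 h)⟩
        have h1 : S.coroot i (u μ - μ) = 0 := hker (S.orbit_sub_mem ⟨u, hu, rfl⟩)
        rw [map_sub, h0, sub_zero] at h1
        rw [s_apply, h1, zero_smul, sub_zero]
        exact ⟨u, hu, rfl⟩
  · exact S.face_mono hsub μ

lemma fund_eq_face {μ : V} (hμ : μ ∈ S.chamber) {F : Set V} (hF : IsFaceOf (S.orbitHull μ) F)
    {x : V} (hx : x ∈ intrinsicInterior ℝ F) (hxC : x ∈ S.chamber) :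
    ∃ K : Set (Fin m), F = S.face μ K := by
  have hxF : x ∈ F := intrinsicInterior_subset hx
  have hHc : Convex ℝ (S.orbitHull μ) := convex_convexHull ℝ _
  let K : Set (Fin m) := {i | S.root i ∈ vectorSpan ℝ F}
  -- points of the hull in the affine span of `F` are in `F`
  have hspan : ∀ y ∈ S.orbitHull μ, x - y ∈ vectorSpan ℝ F → y ∈ F := by
    intro y hy hd
    obtain ⟨ε, hε, hz⟩ := interior_dir hx hd
    refine hF.2.left_mem_of_mem_openSegment hy (hF.2.subset hz) hxF ?_
    refine ⟨ε / (1 + ε), 1 / (1 + ε), by positivity, by positivity, by field_simp; ring, ?_⟩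
    have h1 : ε / (1 + ε) + 1 / (1 + ε) * 1 = 1 := by field_simp; ring
    have h2 : 1 / (1 + ε) * ε = ε / (1 + ε) := by field_simp
    rw [smul_add, smul_smul, h2]
    have h3 : x = (ε / (1 + ε) + 1 / (1 + ε) * 1) • x := by rw [h1, one_smul]
    conv_rhs => rw [h3]
    module
  have hsub : ∀ y ∈ F, x - y ∈ vectorSpan ℝ F := fun y hy => vsub_mem_vectorSpan ℝ hxF hy
  have hstabK : ∀ i ∈ K, ∀ y ∈ F, S.s i y ∈ F := by
    intro i hi y hy
    refine hspan _ (S.orbitHull_mem (S.s_mem_W i) (hF.2.subset hy)) ?_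
    rw [s_apply, ← sub_add]
    exact Submodule.add_mem _ (hsub y hy) (Submodule.smul_mem _ _ hi)
  have hWK : ∀ w ∈ S.WI K, ∀ y ∈ F, w y ∈ F := by
    intro w hw y hy
    obtain ⟨l, hl, rfl⟩ := S.exists_wd_of_mem_WI hw
    clear hw
    induction l with
    | nil => simpa using hy
    | cons i l ih =>
      rw [wd_cons, LinearEquiv.mul_apply]
      exact hstabK i (hl i (by simp)) _ (ih fun i hi => hl i (by simp [hi]))
  have hneg : ∀ i, ∀ y ∈ F, S.coroot i y < 0 → i ∈ K := by
    intro i y hy hneg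
    obtain ⟨ε, hε, hz⟩ := interior_dir hx (hsub y hy)
    set z := x + ε • (x - y) with hzdef
    -- move `y` to its reflection and compensate in `z`
    set d := - S.coroot i y with hd
    have hdpos : 0 < d := by linarith
    have hyr : S.s i y = y + d • S.root i := by rw [s_apply, hd]; module
    have hzc : S.coroot i z = (1 + ε) * S.coroot i x + ε * d := by
      rw [hzdef]; simp only [map_add, map_smul, map_sub, smul_eq_mul]; ring
    have hzpos : ε * d ≤ S.coroot i z := by
      rw [hzc]
      have := hxC i
      nlinarith [mul_nonneg (by positivity : (0:ℝ) ≤ 1 + ε) this]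
    have hεd : 0 < ε * d := by positivity
    set e := S.coroot i z with he
    have hepos : 0 < e := by linarith
    have hz' : z - (ε * d) • S.root i ∈ S.orbitHull μ := by
      have hzH := hF.2.subset hz
      have h1 := S.orbitHull_mem (S.s_mem_W i) hzH
      have h2 := hHc hzH h1 (a := 1 - ε * d / e) (b := ε * d / e)
        (by rw [sub_nonneg, div_le_one hepos]; exact hzpos) (by positivity) (by ring)
      convert h2 using 1
      rw [s_apply, ← he]
      have : ε * d = ε * d / e * e := by field_simp
      conv_lhs => rw [this]
      module
    have hyF : S.s i y ∈ F := by
      refine hF.2.left_mem_of_mem_openSegment (S.orbitHull_mem (S.s_mem_W i) (hF.2.subset hy))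
        hz' hxF ?_
      refine ⟨ε / (1 + ε), 1 / (1 + ε), by positivity, by positivity, by field_simp; ring, ?_⟩
      rw [hyr, hzdef]
      match_scalars <;> field_simp <;> ring
    have h3 : S.s i y -ᵥ y ∈ vectorSpan ℝ F := vsub_mem_vectorSpan ℝ hyF hy
    rw [hyr, vsub_eq_sub, add_sub_cancel_left] at h3
    exact (Submodule.smul_mem_iff _ hdpos.ne').1 h3
  have horb : ∀ y ∈ F ∩ orbitOf S.W μ, y ∈ orbitOf (S.WI K) μ ∧ μ ∈ F := by
    rintro _ ⟨hyF, w, hw, rfl⟩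
    simp only at hyF ⊢
    obtain ⟨u, hu, hud⟩ := S.exists_dominant hμ K (hF.2.subset hyF)
    have huF := hWK u hu _ hyF
    have hdom : (u * w) μ ∈ S.chamber := by
      intro i
      by_contra hc
      push Not at hc
      have := hud i (hneg i _ huF hc)
      rw [LinearEquiv.mul_apply] at hc
      linarith
    have h1 := S.dominant_unique hμ (mul_mem (S.WI_le_W K hu) hw) hdom
    rw [LinearEquiv.mul_apply] at h1
    refine ⟨⟨u⁻¹, inv_mem hu, ?_⟩, h1 ▸ huF⟩
    simp only
    conv_lhs => rw [← h1]
    rw [← LinearEquiv.mul_apply]; simp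
  have hFh := extreme_hull hF.1 hF.2
  have hne : (F ∩ orbitOf S.W μ).Nonempty := by
    rw [← convexHull_nonempty_iff (𝕜 := ℝ), ← hFh]
    exact ⟨x, hxF⟩
  obtain ⟨y, hy⟩ := hne
  have hμF := (horb y hy).2
  refine ⟨K, ?_⟩
  apply Set.Subset.antisymm
  · rw [hFh]
    exact convexHull_mono fun y hy => (horb y hy).1
  · refine convexHull_min ?_ hF.1
    rintro _ ⟨w, hw, rfl⟩
    exact hWK w hw μ hμF

end Helpers

end GCMRealization

open GCMRealization in
theorem statement_11 {m : ℕ} {V : Type*} [NormedAddCommGroup V] [NormedSpace ℝ V]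
    (S : GCMRealization m V) (μ : V) (hμ : μ ∈ S.chamber) :
    (∀ I : Set (Fin m), S.MuConnected μ I →
      S.IsFundFace μ (S.face μ I) ∧ (S.face μ I).Nonempty) ∧
    (∀ F : Set V, S.IsFundFace μ F → F.Nonempty →
      ∃ I : Set (Fin m), S.MuConnected μ I ∧ F = S.face μ I) ∧
    (∀ I I' : Set (Fin m), S.MuConnected μ I → S.MuConnected μ I' →
      (I ⊆ I' ↔ S.face μ I ⊆ S.face μ I')) := by
  refine ⟨fun I _ => ⟨S.face_fund hμ I, ⟨μ, S.mu_mem_face I μ⟩⟩, ?_, ?_⟩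
  · intro F hF hne
    rcases hF.2 with h | ⟨x, hx, hxC⟩
    · exact absurd hne (by simp [h])
    · obtain ⟨K, hK⟩ := S.fund_eq_face hμ hF.1 hx hxC
      exact ⟨S.muPart μ K, S.muPart_connected μ K, by rw [hK]; exact S.face_muPart μ K⟩
  · intro I I' hI _
    exact ⟨fun h => S.face_mono h μ, S.face_subset_imp hI⟩
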